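/- Define I(α) := ∫_0^1 ∫_0^∞ exp( −((2u − u²)/7)·λ² + (8α/7)·u·λ ) dλ du for α ∈ ℝ (so that I(α) = (7/4)·E[T_α] for the expected absorption time of the standard logistic branching process). Then lim_{α → +∞} α²·e^{−16α²/7}·I(α) = 7·√(7π)/32; equivalently, E[T_α] = (4/7)·I(α) ∼ (√(7π)/8)·e^{16α²/7}/α² as α → +∞. -/

import Mathlib

open MeasureTheory Filter
open scoped Topology

noncomputable section

/-- `I(α) = ∫_0^1 ∫_0^∞ exp(-((2u-u²)/7)λ² + (8α/7)uλ) dλ du`, so that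
`I(α) = (7/4)·E[T_α]` for the absorption time of the standard logistic branching process. -/
def absorptionIntegral (α : ℝ) : ℝ :=
  ∫ u in (0 : ℝ)..1, ∫ l in Set.Ioi (0 : ℝ),
    Real.exp (-((2 * u - u ^ 2) / 7) * l ^ 2 + (8 * α / 7) * u * l)

/-- The inner integral of `absorptionIntegral`, rescaled by the peak value `exp (16α²/7)`. -/
def normalizedInner (α u : ℝ) : ℝ :=
  Real.exp (-(16 * α ^ 2) / 7) * ∫ l in Set.Ioi (0 : ℝ),
    Real.exp (-((2 * u - u ^ 2) / 7) * l ^ 2 + (8 * α / 7) * u * l)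

/-- The Gaussian integral over a half line obtained by completing the square. -/
def truncatedGaussian (α u : ℝ) : ℝ :=
  ∫ t in Set.Ioi (-(4 * α / (2 - u))), Real.exp (-((2 * u - u ^ 2) / 7) * t ^ 2)

lemma normalizedInner_eq (α : ℝ) {u : ℝ} (hu : u < 2) :
    normalizedInner α u =
      Real.exp (-(32 * α ^ 2 / 7) * ((1 - u) / (2 - u))) * truncatedGaussian α u := by
  have h2 : (2 - u) ≠ 0 := by linarith
  have h := (measurePreserving_add_right volume (4 * α / (2 - u))).setIntegral_preimage_emb
    (measurableEmbedding_addRight (4 * α / (2 - u)))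
    (fun l => Real.exp (-((2 * u - u ^ 2) / 7) * l ^ 2 + (8 * α / 7) * u * l)) (Set.Ioi 0)
  have hs : (fun x => x + 4 * α / (2 - u)) ⁻¹' Set.Ioi 0 = Set.Ioi (-(4 * α / (2 - u))) := by
    ext x
    simp only [Set.mem_preimage, Set.mem_Ioi]
    constructor <;> intro h <;> linarith
  rw [normalizedInner, truncatedGaussian, ← h, hs, ← integral_const_mul, ← integral_const_mul]
  congr 1
  ext t
  rw [← Real.exp_add, ← Real.exp_add]
  congr 1
  field_simp
  ring

lemma truncatedGaussian_nonneg (α u : ℝ) : 0 ≤ truncatedGaussian α u :=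
  integral_nonneg fun _ => (Real.exp_pos _).le

lemma truncatedGaussian_le (α : ℝ) {u : ℝ} (h0 : 0 < u) (h1 : u ≤ 1) :
    truncatedGaussian α u ≤ √(7 * Real.pi) * u ^ (-(1 / 2) : ℝ) := by
  have ha : 0 < (2 * u - u ^ 2) / 7 := by nlinarith
  calc truncatedGaussian α u
      ≤ ∫ t : ℝ, Real.exp (-((2 * u - u ^ 2) / 7) * t ^ 2) :=
        setIntegral_le_integral (integrable_exp_neg_mul_sq ha)
          (ae_of_all _ fun _ => (Real.exp_pos _).le)
    _ = √(Real.pi / ((2 * u - u ^ 2) / 7)) := integral_gaussian _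
    _ ≤ √(7 * Real.pi / u) := by
        apply Real.sqrt_le_sqrt
        rw [div_div_eq_mul_div, mul_comm]
        apply div_le_div_of_nonneg_left (by positivity) h0
        nlinarith
    _ = √(7 * Real.pi) * u ^ (-(1 / 2) : ℝ) := by
        rw [Real.sqrt_div (by positivity), Real.rpow_neg h0.le, ← Real.sqrt_eq_rpow, div_eq_mul_inv]

lemma normalizedInner_nonneg (α u : ℝ) : 0 ≤ normalizedInner α u :=
  mul_nonneg (Real.exp_pos _).le (integral_nonneg fun _ => (Real.exp_pos _).le)

lemma normalizedInner_le (α : ℝ) {u : ℝ} (h0 : 0 < u) (h1 : u ≤ 1) :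
    normalizedInner α u ≤
      Real.exp (-(16 * α ^ 2 / 7) * (1 - u)) * (√(7 * Real.pi) * u ^ (-(1 / 2) : ℝ)) := by
  rw [normalizedInner_eq α (by linarith)]
  apply mul_le_mul _ (truncatedGaussian_le α h0 h1) (truncatedGaussian_nonneg _ _)
    (Real.exp_pos _).le
  apply Real.exp_le_exp.2
  have h : (1 - u) / 2 ≤ (1 - u) / (2 - u) :=
    div_le_div_of_nonneg_left (by linarith) (by linarith) (by linarith)
  nlinarith [sq_nonneg α]

lemma stronglyMeasurable_normalizedInner (α : ℝ) : StronglyMeasurable (normalizedInner α) := by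
  refine StronglyMeasurable.const_mul (StronglyMeasurable.integral_prod_right ?_) _
  refine Continuous.stronglyMeasurable ?_
  simp only [Function.uncurry_def]
  fun_prop

lemma intervalIntegrable_normalizedInner (α : ℝ) :
    IntervalIntegrable (normalizedInner α) volume 0 1 := by
  have h : IntervalIntegrable (fun u : ℝ => √(7 * Real.pi) * u ^ (-(1 / 2) : ℝ)) volume 0 1 :=
    (intervalIntegral.intervalIntegrable_rpow' (by norm_num)).const_mul _
  refine h.mono_fun (stronglyMeasurable_normalizedInner α).aestronglyMeasurable ?_
  refine (ae_restrict_iff' measurableSet_uIoc).2 (ae_of_all _ fun u hu => ?_)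
  rw [Set.uIoc_of_le zero_le_one] at hu
  beta_reduce
  rw [Real.norm_of_nonneg (normalizedInner_nonneg _ _)]
  refine ((normalizedInner_le α hu.1 hu.2).trans (mul_le_of_le_one_left ?_ ?_)).trans
    (Real.le_norm_self _)
  · exact mul_nonneg (Real.sqrt_nonneg _) (Real.rpow_nonneg hu.1.le _)
  · apply Real.exp_le_one_iff.2
    nlinarith [sq_nonneg α, mul_nonneg (sq_nonneg α) (sub_nonneg.2 hu.2)]

lemma tendsto_integral_normalizedInner_left :
    Tendsto (fun α : ℝ => α ^ 2 * ∫ u in (0 : ℝ)..(1 / 2), normalizedInner α u)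
      atTop (𝓝 0) := by
  set C : ℝ := ∫ u in (0 : ℝ)..(1 / 2), √(7 * Real.pi) * u ^ (-(1 / 2) : ℝ)
  have h_int : IntervalIntegrable (fun u : ℝ => √(7 * Real.pi) * u ^ (-(1 / 2) : ℝ))
      volume 0 (1 / 2) := (intervalIntegral.intervalIntegrable_rpow' (by norm_num)).const_mul _
  have hlim : Tendsto (fun α : ℝ => α ^ 2 * (Real.exp (-(α ^ 2)) * C)) atTop (𝓝 0) := by
    have h := ((Real.tendsto_pow_mul_exp_neg_atTop_nhds_zero 1).comp
      (tendsto_pow_atTop (two_ne_zero (α := ℕ)) : Tendsto (fun α : ℝ => α ^ 2) _ _)).mul_const C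
    simpa [mul_assoc, Function.comp_def] using h
  refine squeeze_zero (fun α => mul_nonneg (sq_nonneg α) ?_)
    (fun α => mul_le_mul_of_nonneg_left ?_ (sq_nonneg α)) hlim
  · exact intervalIntegral.integral_nonneg (by norm_num) fun u _ => normalizedInner_nonneg α u
  · refine (Real.le_norm_self _).trans ?_
    rw [← intervalIntegral.integral_const_mul]
    refine intervalIntegral.norm_integral_le_of_norm_le (by norm_num)
      (ae_of_all _ fun u hu => ?_) (h_int.const_mul _)
    rw [Real.norm_of_nonneg (normalizedInner_nonneg _ _)]
    refine (normalizedInner_le α hu.1 (by linarith [hu.2])).trans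
      (mul_le_mul_of_nonneg_right (Real.exp_le_exp.2 ?_)
        (mul_nonneg (Real.sqrt_nonneg _) (Real.rpow_nonneg hu.1.le _)))
    nlinarith [sq_nonneg α, mul_nonneg (sq_nonneg α) (sub_nonneg.2 hu.2)]

lemma tendsto_one_sub_div_sq (s : ℝ) :
    Tendsto (fun α : ℝ => 1 - s / α ^ 2) atTop (𝓝 1) := by
  simpa using (Tendsto.const_div_atTop (tendsto_pow_atTop (two_ne_zero (α := ℕ))) s).const_sub 1

lemma tendsto_truncatedGaussian {v : ℝ → ℝ} (hv : Tendsto v atTop (𝓝 1)) :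
    Tendsto (fun α => truncatedGaussian α (v α)) atTop (𝓝 √(7 * Real.pi)) := by
  have hv' : ∀ᶠ α in atTop, v α ∈ Set.Ioo (1 / 2 : ℝ) (3 / 2) :=
    hv.eventually (Ioo_mem_nhds (by norm_num) (by norm_num))
  have hG : √(7 * Real.pi) = ∫ t : ℝ, Real.exp (-(1 / 7) * t ^ 2) := by
    rw [integral_gaussian]
    congr 1
    ring
  have hbot : Tendsto (fun α => -(4 * α / (2 - v α))) atTop atBot := by
    refine tendsto_neg_atTop_atBot.comp (tendsto_atTop_mono' _ ?_ tendsto_id)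
    filter_upwards [hv', eventually_ge_atTop 0] with α h hα
    rw [id, le_div_iff₀ (by linarith [h.2])]
    nlinarith [h.1]
  rw [hG]
  simp_rw [truncatedGaussian, ← integral_indicator measurableSet_Ioi]
  refine tendsto_integral_filter_of_dominated_convergence
    (fun t => Real.exp (-(1 / 14) * t ^ 2)) (Eventually.of_forall fun α => ?_) ?_
    (integrable_exp_neg_mul_sq (by norm_num)) (ae_of_all _ fun t => ?_)
  · exact (Continuous.aestronglyMeasurable (by fun_prop)).indicator measurableSet_Ioi
  · filter_upwards [hv'] with α h
    refine ae_of_all _ fun t => (norm_indicator_le_norm_self _ _).trans ?_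
    rw [Real.norm_of_nonneg (Real.exp_pos _).le]
    refine Real.exp_le_exp.2 (mul_le_mul_of_nonneg_right ?_ (sq_nonneg t))
    nlinarith [h.1, h.2]
  · have h : Tendsto (fun α => Real.exp (-((2 * v α - v α ^ 2) / 7) * t ^ 2)) atTop
        (𝓝 (Real.exp (-((2 * 1 - 1 ^ 2) / 7) * t ^ 2))) :=
      (Real.continuous_exp.tendsto _).comp
        (((((hv.const_mul 2).sub (hv.pow 2)).div_const 7).neg).mul_const _)
    rw [show (2 * 1 - 1 ^ 2 : ℝ) / 7 = 1 / 7 by norm_num] at h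
    refine h.congr' ?_
    filter_upwards [hbot.eventually_lt_atBot t] with α hα
    rw [Set.indicator_of_mem (Set.mem_Ioi.2 hα)]

lemma tendsto_normalizedInner (s : ℝ) :
    Tendsto (fun α : ℝ => normalizedInner α (1 - s / α ^ 2)) atTop
      (𝓝 (Real.exp (-(32 / 7) * s) * √(7 * Real.pi))) := by
  have hv := tendsto_one_sub_div_sq s
  have hexp : Tendsto (fun α : ℝ => Real.exp (-(32 / 7) * s / (2 - (1 - s / α ^ 2)))) atTop
      (𝓝 (Real.exp (-(32 / 7) * s / (2 - 1)))) :=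
    (Real.continuous_exp.tendsto _).comp
      (tendsto_const_nhds.div (hv.const_sub 2) (by norm_num))
  rw [show (2 : ℝ) - 1 = 1 by norm_num, div_one] at hexp
  refine (hexp.mul (tendsto_truncatedGaussian hv)).congr' ?_
  filter_upwards [hv.eventually_lt_const one_lt_two, eventually_gt_atTop 0] with α h hα
  rw [normalizedInner_eq α h]
  congr 2
  have h2 : 2 - (1 - s / α ^ 2) ≠ 0 := by linarith
  have h3 : 1 - (1 - s / α ^ 2) = s / α ^ 2 := by ring
  rw [h3]
  field_simp

lemma tendsto_integral_normalizedInner_right :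
    Tendsto (fun α : ℝ => α ^ 2 * ∫ u in (1 / 2 : ℝ)..1, normalizedInner α u)
      atTop (𝓝 (7 * √(7 * Real.pi) / 32)) := by
  have hval : ∫ s in Set.Ioi (0 : ℝ), Real.exp (-(32 / 7) * s) * √(7 * Real.pi) =
      7 * √(7 * Real.pi) / 32 := by
    rw [integral_mul_const, integral_exp_mul_Ioi (by norm_num)]
    norm_num
    ring
  have hsub : ∀ᶠ α : ℝ in atTop,
      ∫ s in Set.Ioi (0 : ℝ), (Set.Ioc 0 (α ^ 2 / 2)).indicator
        (fun s => normalizedInner α (1 - s / α ^ 2)) s =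
      α ^ 2 * ∫ u in (1 / 2 : ℝ)..1, normalizedInner α u := by
    filter_upwards [eventually_gt_atTop 0] with α hα
    have h := intervalIntegral.integral_comp_sub_div (a := 0) (b := α ^ 2 / 2)
      (normalizedInner α) (pow_pos hα 2).ne' 1
    rw [setIntegral_indicator measurableSet_Ioc,
      Set.inter_eq_self_of_subset_right Set.Ioc_subset_Ioi_self,
      ← intervalIntegral.integral_of_le (by positivity), h, smul_eq_mul]
    have h1 : 1 - α ^ 2 / 2 / α ^ 2 = 1 / 2 := by
      field_simp
      norm_num
    rw [h1, zero_div, sub_zero]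
  rw [← hval]
  refine Tendsto.congr' hsub ?_
  refine tendsto_integral_filter_of_dominated_convergence
    (fun s => Real.exp (-(16 / 7) * s) * (√(7 * Real.pi) * (1 / 2) ^ (-(1 / 2) : ℝ)))
    (Eventually.of_forall fun α => ?_) ?_
    ((exp_neg_integrableOn_Ioi 0 (by norm_num)).mul_const _) ?_
  · exact (((stronglyMeasurable_normalizedInner α).comp_measurable
      (by fun_prop)).indicator measurableSet_Ioc).aestronglyMeasurable
  · filter_upwards [eventually_gt_atTop 0] with α hα
    refine ae_of_all _ fun s => ?_
    have hα2 : 0 < α ^ 2 := pow_pos hα 2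
    by_cases hs : s ∈ Set.Ioc 0 (α ^ 2 / 2)
    · rw [Set.indicator_of_mem hs, Real.norm_of_nonneg (normalizedInner_nonneg _ _)]
      have h1 : s / α ^ 2 ≤ 1 / 2 := by
        rw [div_le_iff₀ hα2]
        linarith [hs.2]
      have h0 : 0 < s / α ^ 2 := div_pos hs.1 hα2
      refine (normalizedInner_le α (by linarith) (by linarith)).trans ?_
      have he : -(16 * α ^ 2 / 7) * (1 - (1 - s / α ^ 2)) = -(16 / 7) * s := by
        field_simp
        ring
      rw [he]
      refine mul_le_mul_of_nonneg_left (mul_le_mul_of_nonneg_left ?_ (Real.sqrt_nonneg _))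
        (Real.exp_pos _).le
      exact Real.rpow_le_rpow_of_nonpos (by norm_num) (by linarith) (by norm_num)
    · rw [Set.indicator_of_notMem hs, norm_zero]
      positivity
  · refine (ae_restrict_iff' measurableSet_Ioi).2 (ae_of_all _ fun s hs => ?_)
    refine (tendsto_normalizedInner s).congr' ?_
    have hsq : Tendsto (fun α : ℝ => α ^ 2 / 2) atTop atTop :=
      (tendsto_pow_atTop two_ne_zero).atTop_div_const two_pos
    filter_upwards [hsq.eventually_ge_atTop s] with α hα
    rw [Set.indicator_of_mem (Set.mem_Ioc.2 ⟨hs, hα⟩)]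

/-- As `α → +∞`, `α² e^{-16α²/7} I(α) → 7√(7π)/32`; equivalently
`E[T_α] = (4/7) I(α) ∼ (√(7π)/8) e^{16α²/7}/α²`. -/
theorem absorptionIntegral_asymptotic_top :
    Tendsto (fun α : ℝ => α ^ 2 * Real.exp (-(16 * α ^ 2) / 7) * absorptionIntegral α)
      atTop (𝓝 (7 * Real.sqrt (7 * Real.pi) / 32)) := by
  have h := tendsto_integral_normalizedInner_left.add tendsto_integral_normalizedInner_right
  rw [zero_add] at h
  refine h.congr fun α => ?_
  have h_int := intervalIntegrable_normalizedInner α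
  rw [← mul_add, intervalIntegral.integral_add_adjacent_intervals
    (h_int.mono_set (Set.uIcc_subset_uIcc_left (by norm_num [Set.mem_uIcc])))
    (h_int.mono_set (Set.uIcc_subset_uIcc_right (by norm_num [Set.mem_uIcc])))]
  simp only [normalizedInner, absorptionIntegral, intervalIntegral.integral_const_mul, mul_assoc]

end
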